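/- Let 0 ≤ q < 1 and β > 0. For every complex polynomial F(z) = ∑_{n=0}^N a_n z^n, the squared L²(ν_q)-norm of F equals the weighted ℓ²-sum of its coefficients: (q;q)_∞ · ∑_{j=0}^∞ (q^j/(q;q)_j) · (1/(2π)) ∫_0^{2π} |F(r_j e^{iθ})|² dθ = ∑_{n=0}^N β^n · [n]_q! · |a_n|². In particular, the map sending a function f with orthogonal expansion coefficients (a_n) in L²(μ_p^{(q)}) (whose squared norm is ∑_n β^n [n]_q! |a_n|²) to the power series ∑_n a_n z^n is an isometry into L²(ν_q) on polynomial expansions. -/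

import Mathlib

/-- The q-integer `[n]_q = 1 + q + ⋯ + q^(n-1)`. -/
noncomputable def qInt (q : ℝ) (n : ℕ) : ℝ := ∑ i ∈ Finset.range n, q ^ i

/-- The q-factorial `[n]_q! = [1]_q ⋯ [n]_q`. -/
noncomputable def qFact (q : ℝ) (n : ℕ) : ℝ := ∏ i ∈ Finset.range n, qInt q (i + 1)

/-- The q-Pochhammer symbol `(a;q)_n = ∏_{j=0}^{n-1} (1 - a q^j)`. -/
noncomputable def qPoch (a q : ℝ) (n : ℕ) : ℝ := ∏ j ∈ Finset.range n, (1 - a * q ^ j)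

/-- The infinite q-Pochhammer symbol `(a;q)_∞ = ∏_{j=0}^{∞} (1 - a q^j)`. -/
noncomputable def qPochInf (a q : ℝ) : ℝ := ∏' j : ℕ, (1 - a * q ^ j)

/-- The radius `r_j = q^{j/2} √(β/(1-q))`. -/
noncomputable def rRad (q β : ℝ) (j : ℕ) : ℝ := Real.sqrt (q ^ j) * Real.sqrt (β / (1 - q))

theorem qPoch_succ (a q : ℝ) (n : ℕ) : qPoch a q (n + 1) = qPoch a q n * (1 - a * q ^ n) :=
  Finset.prod_range_succ _ _

theorem one_sub_mul_pow_self_pos {q : ℝ} (hq0 : 0 ≤ q) (hq1 : q < 1) (j : ℕ) :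
    0 < 1 - q * q ^ j := by
  rw [← pow_succ']
  exact sub_pos.2 (pow_lt_one₀ hq0 hq1 j.succ_ne_zero)

theorem qPoch_self_pos {q : ℝ} (hq0 : 0 ≤ q) (hq1 : q < 1) (n : ℕ) : 0 < qPoch q q n :=
  Finset.prod_pos fun j _ => one_sub_mul_pow_self_pos hq0 hq1 j

theorem qPoch_self_eq_pow_mul_qFact (q : ℝ) (n : ℕ) : qPoch q q n = (1 - q) ^ n * qFact q n := by
  induction n with
  | zero => simp [qPoch, qFact]
  | succ n ih =>
    rw [qPoch_succ, ih, qFact, qFact, Finset.prod_range_succ, qInt, ← pow_succ',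
      ← mul_neg_geom_sum]
    ring

theorem summable_norm_neg_mul_pow {q : ℝ} (hq0 : 0 ≤ q) (hq1 : q < 1) (a : ℝ) :
    Summable fun j : ℕ => ‖-(a * q ^ j)‖ := by
  simpa [abs_mul, abs_of_nonneg hq0] using (summable_geometric_of_lt_one hq0 hq1).mul_left |a|

theorem tendsto_qPoch {q : ℝ} (hq0 : 0 ≤ q) (hq1 : q < 1) (a : ℝ) :
    Filter.Tendsto (qPoch a q) Filter.atTop (nhds (qPochInf a q)) := by
  have h := (multipliable_one_add_of_summable
    (summable_norm_neg_mul_pow hq0 hq1 a)).hasProd.tendsto_prod_nat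
  simp only [← sub_eq_add_neg] at h
  exact h

theorem qPochInf_self_ne_zero {q : ℝ} (hq0 : 0 ≤ q) (hq1 : q < 1) : qPochInf q q ≠ 0 := by
  have h := tprod_one_add_ne_zero_of_summable (f := fun j : ℕ => -(q * q ^ j))
    (fun j => by
      rw [← sub_eq_add_neg]
      exact (one_sub_mul_pow_self_pos hq0 hq1 j).ne')
    (summable_norm_neg_mul_pow hq0 hq1 q)
  simp only [← sub_eq_add_neg] at h
  exact h

theorem sum_range_succ_pow_div_qPoch {q : ℝ} (hq0 : 0 ≤ q) (hq1 : q < 1) (n : ℕ) :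
    ∑ j ∈ Finset.range (n + 1), q ^ j / qPoch q q j = (qPoch q q n)⁻¹ := by
  induction n with
  | zero => simp [qPoch]
  | succ n ih =>
    have h₁ := (qPoch_self_pos hq0 hq1 n).ne'
    have h₂ := (one_sub_mul_pow_self_pos hq0 hq1 n).ne'
    rw [Finset.sum_range_succ, ih, qPoch_succ]
    field_simp
    ring

theorem hasSum_pow_div_qPoch_mul_pow {q : ℝ} (hq0 : 0 ≤ q) (hq1 : q < 1) (n : ℕ) :
    HasSum (fun j => q ^ j / qPoch q q j * (q ^ j) ^ n) (qPoch q q n / qPochInf q q) := by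
  induction n with
  | zero =>
    rw [hasSum_iff_tendsto_nat_of_nonneg
        fun j => mul_nonneg (div_nonneg (pow_nonneg hq0 _) (qPoch_self_pos hq0 hq1 j).le) (by simp),
      ← Filter.tendsto_add_atTop_iff_nat 1]
    simp only [pow_zero, mul_one, sum_range_succ_pow_div_qPoch hq0 hq1]
    simpa [qPoch] using (tendsto_qPoch hq0 hq1 q).inv₀ (qPochInf_self_ne_zero hq0 hq1)
  | succ n ih =>
    have h : HasSum (fun j => q ^ j / qPoch q q j * (q ^ j) ^ n * (1 - q ^ j))
        (q ^ (n + 1) * (qPoch q q n / qPochInf q q)) := by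
      rw [← hasSum_nat_add_iff' 1]
      simp only [Finset.sum_range_one, pow_zero, sub_self, mul_zero, sub_zero]
      refine (ih.mul_left (q ^ (n + 1))).congr_fun fun j => ?_
      have h₁ := (qPoch_self_pos hq0 hq1 j).ne'
      have h₂ := (one_sub_mul_pow_self_pos hq0 hq1 j).ne'
      rw [qPoch_succ, pow_succ' q j]
      field_simp
      ring
    have hval : qPoch q q (n + 1) / qPochInf q q =
        qPoch q q n / qPochInf q q - q ^ (n + 1) * (qPoch q q n / qPochInf q q) := by
      rw [qPoch_succ]
      ring
    rw [hval]
    exact (ih.sub h).congr_fun fun j => by ring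

theorem integral_exp_int_mul_I (k : ℤ) :
    ∫ θ in (0 : ℝ)..(2 * Real.pi), Complex.exp (k * Complex.I * θ) =
      if k = 0 then ((2 * Real.pi : ℝ) : ℂ) else 0 := by
  split_ifs with hk
  · simp [hk]
  · rw [integral_exp_mul_complex (by simp [hk])]
    have : (k : ℂ) * Complex.I * ((2 * Real.pi : ℝ) : ℂ) = k * (2 * Real.pi * Complex.I) := by
      push_cast
      ring
    rw [this, Complex.exp_int_mul_two_pi_mul_I]
    simp

/-- Parseval's identity for a trigonometric polynomial. -/
theorem integral_norm_sq_sum_mul_exp_pow (s : Finset ℕ) (c : ℕ → ℂ) :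
    ∫ θ in (0 : ℝ)..(2 * Real.pi), ‖∑ n ∈ s, c n * Complex.exp (θ * Complex.I) ^ n‖ ^ 2 =
      2 * Real.pi * ∑ n ∈ s, ‖c n‖ ^ 2 := by
  have expand (θ : ℝ) : ((‖∑ n ∈ s, c n * Complex.exp (θ * Complex.I) ^ n‖ ^ 2 : ℝ) : ℂ) =
      ∑ m ∈ s, ∑ n ∈ s, c m * (starRingEnd ℂ) (c n) *
        Complex.exp (((m - n : ℤ) : ℂ) * Complex.I * θ) := by
    rw [Complex.ofReal_pow, ← Complex.mul_conj', map_sum, Finset.sum_mul_sum]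
    refine Finset.sum_congr rfl fun m _ => Finset.sum_congr rfl fun n _ => ?_
    rw [map_mul, map_pow, ← Complex.exp_conj, ← Complex.exp_nat_mul, ← Complex.exp_nat_mul,
      mul_mul_mul_comm, ← Complex.exp_add]
    congr 2
    simp
    ring
  apply Complex.ofReal_injective
  rw [← intervalIntegral.integral_ofReal]
  simp only [expand]
  rw [intervalIntegral.integral_finsetSum
    fun m _ => Continuous.intervalIntegrable (by fun_prop) _ _]
  rw [Complex.ofReal_mul, Complex.ofReal_sum, Finset.mul_sum]
  refine Finset.sum_congr rfl fun m hm => ?_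
  rw [intervalIntegral.integral_finsetSum
    fun n _ => Continuous.intervalIntegrable (by fun_prop) _ _]
  rw [Finset.sum_eq_single_of_mem m hm]
  · rw [intervalIntegral.integral_const_mul, integral_exp_int_mul_I, Complex.mul_conj']
    simp [mul_comm]
  · intro n _ hn
    rw [intervalIntegral.integral_const_mul, integral_exp_int_mul_I, if_neg (by omega), mul_zero]

theorem rRad_sq {q β : ℝ} (hq0 : 0 ≤ q) (hq1 : q < 1) (hβ : 0 ≤ β) (j : ℕ) :
    rRad q β j ^ 2 = q ^ j * (β / (1 - q)) := by
  rw [rRad, mul_pow, Real.sq_sqrt (pow_nonneg hq0 j),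
    Real.sq_sqrt (div_nonneg hβ (sub_nonneg.2 hq1.le))]

/-- The Segal–Bargmann transform is an isometry on polynomial expansions:
for `F(z) = ∑_{n=0}^N a_n z^n`,
`‖F‖²_{L²(ν_q)} = ∑_{n=0}^N β^n [n]_q! |a_n|²`. -/
theorem segalBargmann_isometry_polynomials (q β : ℝ) (hq0 : 0 ≤ q) (hq1 : q < 1)
    (hβ : 0 < β) (N : ℕ) (a : ℕ → ℂ) :
    qPochInf q q *
      ∑' j : ℕ, (q ^ j / qPoch q q j) * (1 / (2 * Real.pi)) *
        ∫ θ in (0 : ℝ)..(2 * Real.pi),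
          ‖∑ n ∈ Finset.range (N + 1),
              a n * (((rRad q β j : ℝ) : ℂ) * Complex.exp (θ * Complex.I)) ^ n‖ ^ 2
      = ∑ n ∈ Finset.range (N + 1), β ^ n * qFact q n * ‖a n‖ ^ 2 := by
  have hterm (j : ℕ) : (q ^ j / qPoch q q j) * (1 / (2 * Real.pi)) *
        ∫ θ in (0 : ℝ)..(2 * Real.pi),
          ‖∑ n ∈ Finset.range (N + 1),
              a n * (((rRad q β j : ℝ) : ℂ) * Complex.exp (θ * Complex.I)) ^ n‖ ^ 2 =
      ∑ n ∈ Finset.range (N + 1),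
        (‖a n‖ ^ 2 * (β / (1 - q)) ^ n) * (q ^ j / qPoch q q j * (q ^ j) ^ n) := by
    simp only [mul_pow, ← mul_assoc]
    rw [integral_norm_sq_sum_mul_exp_pow, ← mul_assoc, mul_assoc (q ^ j / qPoch q q j),
      one_div_mul_cancel Real.two_pi_pos.ne', mul_one, Finset.mul_sum]
    refine Finset.sum_congr rfl fun n _ => ?_
    rw [norm_mul, norm_pow, Complex.norm_real, mul_pow, pow_right_comm, Real.norm_eq_abs, sq_abs,
      rRad_sq hq0 hq1 hβ.le, mul_pow]
    ring
  simp only [hterm]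
  rw [(hasSum_sum fun n _ => (hasSum_pow_div_qPoch_mul_pow hq0 hq1 n).mul_left _).tsum_eq,
    Finset.mul_sum]
  refine Finset.sum_congr rfl fun n _ => ?_
  have h₁ := qPochInf_self_ne_zero hq0 hq1
  have h₂ : 1 - q ≠ 0 := (sub_pos.2 hq1).ne'
  rw [qPoch_self_eq_pow_mul_qFact, div_pow]
  field_simp
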